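/- Let E be a TOM on a finite vertex set V with internal space ℂ^d admitting an overlapping factorization E = (E_L ⊕ I₊)(I₋ ⊕ E_R) with overlap V₀ along a partition V = V₋ ∪ V₀ ∪ V₊, and suppose the sum of sites S₀ indexed by V₀ is recurrent for E_L. Then for every density ρ supported on S₀: if π_R(ρ→S₀) = 1, so that σ := f_R(1)(ρ) is a density supported on S₀, the expected return times satisfy τ(ρ→S₀) + 1 = τ_L(σ→S₀) + τ_R(ρ→S₀) as elements of [1, ∞]; and if π_R(ρ→S₀) < 1 then τ(ρ→S₀) = ∞. Consequently S₀ is positive recurrent for E whenever it is positive recurrent for both E_L and E_R. -/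

import Mathlib

open Matrix Filter
open scoped ComplexOrder ENNReal

namespace QMCTOM

variable {d : ℕ} {V : Type} [Fintype V] [DecidableEq V]

/-- A completely positive map on `M_d(ℂ)`: one admitting a finite Kraus
representation. -/
def IsCPMap (Φ : Matrix (Fin d) (Fin d) ℂ →ₗ[ℂ] Matrix (Fin d) (Fin d) ℂ) : Prop :=
  ∃ (m : ℕ) (B : Fin m → Matrix (Fin d) (Fin d) ℂ),
    ∀ ρ, Φ ρ = ∑ i, B i * ρ * (B i)ᴴ

/-- A transition operator matrix (TOM) supported on a subset `S` of the vertex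
set `V`: a family of CP maps `E i j`, vanishing unless `i, j ∈ S`, whose column
sums over `S` are trace preserving. A TOM on `V` itself corresponds to
`S = Finset.univ`. -/
def IsTOMOn (S : Finset V)
    (E : V → V → (Matrix (Fin d) (Fin d) ℂ →ₗ[ℂ] Matrix (Fin d) (Fin d) ℂ)) : Prop :=
  (∀ i j, IsCPMap (E i j)) ∧
  (∀ i j, (i ∉ S ∨ j ∉ S) → E i j = 0) ∧
  (∀ j ∈ S, ∀ ρ : Matrix (Fin d) (Fin d) ℂ, (∑ i, (E i j) ρ).trace = ρ.trace)

/-- The action of a TOM on block-diagonal operators `(ρ_j)_{j∈V}`: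
`(Eρ)_i = Σ_j E_i^j(ρ_j)`. -/
noncomputable def tomAct
    (E : V → V → (Matrix (Fin d) (Fin d) ℂ →ₗ[ℂ] Matrix (Fin d) (Fin d) ℂ)) :
    (V → Matrix (Fin d) (Fin d) ℂ) →ₗ[ℂ] (V → Matrix (Fin d) (Fin d) ℂ) where
  toFun ρ i := ∑ j, E i j (ρ j)
  map_add' x y := by
    funext i
    simp [map_add, Finset.sum_add_distrib]
  map_smul' c x := by
    funext i
    simp [_root_.map_smul, Finset.smul_sum]

/-- The projection `ℙ₀` of block-diagonal operators zeroing all components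
outside `S`. -/
noncomputable def siteProj (S : Finset V) :
    (V → Matrix (Fin d) (Fin d) ℂ) →ₗ[ℂ] (V → Matrix (Fin d) (Fin d) ℂ) where
  toFun ρ i := if i ∈ S then ρ i else 0
  map_add' x y := by
    funext i
    by_cases h : i ∈ S <;> simp [h]
  map_smul' c x := by
    funext i
    by_cases h : i ∈ S <;> simp [h]

/-- Total trace of a block-diagonal operator. -/
noncomputable def blockTrace (ρ : V → Matrix (Fin d) (Fin d) ℂ) : ℂ :=
  ∑ i, (ρ i).trace

/-- `retA E S n` is `𝔸_{n+1} = ℙ₀ ∘ E ∘ (ℚ₀∘E)^n ∘ ℙ₀`, where `ℙ₀ = siteProj S`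
and `ℚ₀ = id − ℙ₀`. -/
noncomputable def retA
    (E : V → V → (Matrix (Fin d) (Fin d) ℂ →ₗ[ℂ] Matrix (Fin d) (Fin d) ℂ))
    (S : Finset V) (n : ℕ) :
    (V → Matrix (Fin d) (Fin d) ℂ) →ₗ[ℂ] (V → Matrix (Fin d) (Fin d) ℂ) :=
  (siteProj S) ∘ₗ (tomAct E) ∘ₗ
    (((LinearMap.id - siteProj S) ∘ₗ tomAct E) ^ n) ∘ₗ (siteProj S)

/-- A density supported on the sum of sites indexed by `S`. -/
def DensityOn (S : Finset V) (ρ : V → Matrix (Fin d) (Fin d) ℂ) : Prop :=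
  (∀ j, (ρ j).PosSemidef) ∧ (∀ j ∉ S, ρ j = 0) ∧ blockTrace ρ = 1

/-- Return probability `π(ρ→S₀) = Σ_{n≥1} Tr(𝔸_n(ρ))`. -/
noncomputable def returnProb
    (E : V → V → (Matrix (Fin d) (Fin d) ℂ →ₗ[ℂ] Matrix (Fin d) (Fin d) ℂ))
    (S : Finset V) (ρ : V → Matrix (Fin d) (Fin d) ℂ) : ℝ :=
  ∑' n : ℕ, (blockTrace ((retA E S n) ρ)).re

/-- Expected return time `τ(ρ→S₀) = Σ_{n≥1} n·Tr(𝔸_n(ρ))` if `π(ρ→S₀) = 1`,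
and `∞` otherwise. -/
noncomputable def expReturnTime
    (E : V → V → (Matrix (Fin d) (Fin d) ℂ →ₗ[ℂ] Matrix (Fin d) (Fin d) ℂ))
    (S : Finset V) (ρ : V → Matrix (Fin d) (Fin d) ℂ) : ℝ≥0∞ :=
  if returnProb E S ρ = 1 then
    ∑' n : ℕ, ENNReal.ofReal ((n + 1) * (blockTrace ((retA E S n) ρ)).re)
  else ⊤

/-- The sum of sites `S` is recurrent for `E`. -/
def RecurrentOn
    (E : V → V → (Matrix (Fin d) (Fin d) ℂ →ₗ[ℂ] Matrix (Fin d) (Fin d) ℂ))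
    (S : Finset V) : Prop :=
  ∀ ρ, DensityOn S ρ → returnProb E S ρ = 1

/-- The sum of sites `S` is positive recurrent for `E`. -/
def PosRecurrentOn
    (E : V → V → (Matrix (Fin d) (Fin d) ℂ →ₗ[ℂ] Matrix (Fin d) (Fin d) ℂ))
    (S : Finset V) : Prop :=
  ∀ ρ, DensityOn S ρ → expReturnTime E S ρ < ⊤


/-- Extension of a (zero-extended) TOM by the identity on the sites in `S`:
the matrix of maps `E ⊕ I_S` with entries `E i j` plus the identity on the
diagonal entries indexed by `S`. -/
noncomputable def extById (S : Finset V)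
    (E : V → V → (Matrix (Fin d) (Fin d) ℂ →ₗ[ℂ] Matrix (Fin d) (Fin d) ℂ)) :
    V → V → (Matrix (Fin d) (Fin d) ℂ →ₗ[ℂ] Matrix (Fin d) (Fin d) ℂ) :=
  fun i j => E i j + (if i = j ∧ i ∈ S then LinearMap.id else 0)

set_option linter.unusedSectionVars false

section Ring

/-- First-passage decomposition of the taboo powers of `(A + p) * (B + m)`, where `e`, `m`, `p` are
complementary idempotents such that `A` does not touch `p` and `B` does not touch `m`. -/
theorem taboo_pow_mul_eq {R : Type*} [Ring R] {e m p A B : R}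
    (hone : m + e + p = 1) (hmm : m * m = m) (hpp : p * p = p) (hme : m * e = 0)
    (hmp : m * p = 0) (hpm : p * m = 0)
    (hpA : p * A = 0) (hAp : A * p = 0) (hmB : m * B = 0) (hBm : B * m = 0) (n : ℕ) :
    ((1 - e) * ((A + p) * (B + m))) ^ n * e =
      ((1 - e) * B) ^ n * e +
        ∑ k ∈ Finset.range n, ((1 - e) * A) ^ (n - k) * (e * (B * (((1 - e) * B) ^ k * e))) := by
  have hq : 1 - e = m + p := by rw [← hone]; abel
  have hQA : (1 - e) * A = m * A := by rw [hq, add_mul, hpA, add_zero]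
  have hQB : (1 - e) * B = p * B := by rw [hq, add_mul, hmB, zero_add]
  have hQE : (1 - e) * ((A + p) * (B + m)) = m * A * B + m * A * m + p * B := by
    rw [hq]
    simp only [add_mul, mul_add, ← mul_assoc, hmp, hpp, hpA, hpm, zero_add, add_zero]
    abel
  rw [hQA, hQB, hQE]
  have hz : ∀ n, m * ((p * B) ^ n * e) = 0 := by
    rintro (_ | n)
    · simp [hme]
    · rw [pow_succ']; simp only [← mul_assoc, hmp, zero_mul]
  have hAz : ∀ n, A * ((p * B) ^ (n + 1) * e) = 0 := fun n => by
    rw [pow_succ']; simp only [← mul_assoc, hAp, zero_mul]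
  have hBx : ∀ (j : ℕ) (w : R), B * ((m * A) ^ (j + 1) * w) = 0 := fun j w => by
    rw [pow_succ']; simp only [← mul_assoc, hBm, zero_mul]
  have hmx : ∀ (j : ℕ) (w : R), m * ((m * A) ^ (j + 1) * w) = (m * A) ^ (j + 1) * w :=
    fun j w => by rw [pow_succ']; simp only [← mul_assoc, hmm]
  induction n with
  | zero => simp
  | succ n ih =>
    rw [pow_succ', mul_assoc, ih, mul_add, Finset.mul_sum, Finset.sum_range_succ]
    have h1 : (m * A * B + m * A * m + p * B) * ((p * B) ^ n * e) =
        (p * B) ^ (n + 1) * e + (m * A) * (e * (B * ((p * B) ^ n * e))) := by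
      have h2 : B * ((p * B) ^ n * e) =
          e * (B * ((p * B) ^ n * e)) + (p * B) ^ (n + 1) * e := by
        have hB : B = e * B + p * B := by
          conv_lhs => rw [← one_mul B, ← hone, add_mul, add_mul, hmB, zero_add]
        have h := congrArg (· * ((p * B) ^ n * e)) hB
        rw [pow_succ']
        simpa only [add_mul, mul_assoc] using h
      calc _ = m * A * (B * ((p * B) ^ n * e)) + m * A * (m * ((p * B) ^ n * e)) +
              p * B * ((p * B) ^ n * e) := by noncomm_ring
        _ = m * A * (e * (B * ((p * B) ^ n * e)) + (p * B) ^ (n + 1) * e) +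
              m * A * (m * ((p * B) ^ n * e)) + p * B * ((p * B) ^ n * e) := by rw [← h2]
        _ = _ := by
          rw [hz, mul_zero, add_zero, mul_add, mul_assoc m A ((p * B) ^ (n + 1) * e), hAz,
            mul_zero, add_zero, pow_succ', mul_assoc (p * B), add_comm]
    have h3 : ∀ k ∈ Finset.range n, (m * A * B + m * A * m + p * B) *
        ((m * A) ^ (n - k) * (e * (B * ((p * B) ^ k * e)))) =
        (m * A) ^ (n + 1 - k) * (e * (B * ((p * B) ^ k * e))) := by
      intro k hk
      obtain ⟨j, hj⟩ : ∃ j, n - k = j + 1 :=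
        ⟨n - k - 1, by have := Finset.mem_range.1 hk; omega⟩
      have hj' : n + 1 - k = j + 1 + 1 := by omega
      rw [hj, hj', add_mul, add_mul, mul_assoc (m * A) B, hBx, mul_assoc (m * A) m, hmx,
        mul_assoc p B, hBx, mul_zero, mul_zero, zero_add, add_zero, pow_succ' _ (j + 1),
        mul_assoc (m * A)]
    rw [h1, Finset.sum_congr rfl h3, Nat.add_sub_cancel_left, pow_one]
    abel

/-- The first-return coefficients of `(A + p) * (B + m)` to `e` are the Cauchy product of those of
`A` and `B`. -/
theorem first_return_eq_sum_antidiagonal {R : Type*} [Ring R] {e m p A B : R}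
    (hone : m + e + p = 1) (hee : e * e = e) (hmm : m * m = m) (hpp : p * p = p)
    (hme : m * e = 0) (hep : e * p = 0)
    (hmp : m * p = 0) (hpm : p * m = 0)
    (hpA : p * A = 0) (hAp : A * p = 0) (hmB : m * B = 0) (hBm : B * m = 0) (n : ℕ) :
    e * (((A + p) * (B + m)) * (((1 - e) * ((A + p) * (B + m))) ^ n * e)) =
      ∑ x ∈ Finset.HasAntidiagonal.antidiagonal n, (e * (A * (((1 - e) * A) ^ x.2 * e))) *
        (e * (B * (((1 - e) * B) ^ x.1 * e))) := by
  rw [taboo_pow_mul_eq hone hmm hpp hme hmp hpm hpA hAp hmB hBm,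
    Finset.Nat.sum_antidiagonal_eq_sum_range_succ
      (fun i j => (e * (A * (((1 - e) * A) ^ j * e))) * (e * (B * (((1 - e) * B) ^ i * e)))),
    Finset.sum_range_succ]
  have hq : 1 - e = m + p := by rw [← hone]; abel
  have hQA : (1 - e) * A = m * A := by rw [hq, add_mul, hpA, add_zero]
  have hQB : (1 - e) * B = p * B := by rw [hq, add_mul, hmB, zero_add]
  have hE : e * ((A + p) * (B + m)) = e * A * B + e * A * m := by
    simp only [add_mul, mul_add, ← mul_assoc, hep, zero_mul, add_zero]
  have hB : B = e * B + p * B := by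
    conv_lhs => rw [← one_mul B, ← hone, add_mul, add_mul, hmB, zero_add]
  have hz : m * ((p * B) ^ n * e) = 0 := by
    rcases n with _ | n
    · simp [hme]
    · rw [pow_succ']; simp only [← mul_assoc, hmp, zero_mul]
  rw [hQA, hQB, ← mul_assoc, hE, mul_add, Finset.mul_sum, add_comm]
  congr 1
  · refine Finset.sum_congr rfl fun k hk => ?_
    obtain ⟨j, hj⟩ : ∃ j, n - k = j + 1 :=
      ⟨n - k - 1, by have := Finset.mem_range.1 hk; omega⟩
    rw [hj, pow_succ']
    simp only [add_mul, ← mul_assoc]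
    rw [mul_assoc (e * A) B m, hBm, mul_assoc (e * A) m m, hmm, mul_assoc _ e e, hee]
    simp
  · rw [Nat.sub_self, pow_zero, one_mul, add_mul, mul_assoc (e * A) m, hz, mul_zero, add_zero,
      mul_assoc (e * A) B]
    generalize (p * B) ^ n = X
    conv_lhs => rw [hB]
    simp only [add_mul, mul_add, ← mul_assoc]
    rw [mul_assoc e A p, hAp, mul_assoc _ e e, hee]
    simp

end Ring

theorem tsum_sum_antidiagonal_ennreal (f : ℕ × ℕ → ℝ≥0∞) :
    ∑' n, ∑ x ∈ Finset.HasAntidiagonal.antidiagonal n, f x = ∑' k, ∑' m, f (k, m) := by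
  rw [← ENNReal.tsum_prod' (f := f), ← Finset.HasAntidiagonal.sigmaAntidiagonalEquivProd.tsum_eq,
    ENNReal.tsum_sigma']
  refine tsum_congr fun n => ?_
  rw [tsum_fintype]
  exact (Finset.sum_coe_sort (Finset.HasAntidiagonal.antidiagonal n) f).symm

theorem tsum_eq_one_iff_tsum_ofReal {f : ℕ → ℝ} (hf : ∀ n, 0 ≤ f n) :
    ∑' n, f n = 1 ↔ ∑' n, ENNReal.ofReal (f n) = 1 := by
  constructor
  · intro h
    have hs : Summable f := by
      by_contra hs
      simp [tsum_eq_zero_of_not_summable hs] at h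
    rw [← ENNReal.ofReal_tsum_of_nonneg hf hs, h, ENNReal.ofReal_one]
  · intro h
    have := ENNReal.tsum_toReal_eq (f := fun n => ENNReal.ofReal (f n)) (by simp)
    simpa [h, ENNReal.toReal_ofReal (hf _)] using this.symm

theorem norm_entry_le_re_trace {M : Matrix (Fin d) (Fin d) ℂ} (hM : M.PosSemidef)
    (a b : Fin d) : ‖M a b‖ ≤ M.trace.re := by
  have hdiag : ∀ i, 0 ≤ (M i i).re := fun i => (Complex.le_def.1 (hM.diag_nonneg (i := i))).1
  have himag : ∀ i, (M i i).im = 0 := fun i =>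
    (Complex.le_def.1 (hM.diag_nonneg (i := i))).2.symm
  have hle : ∀ i, (M i i).re ≤ M.trace.re := fun i => by
    rw [Matrix.trace, Complex.re_sum]
    exact Finset.single_le_sum (f := fun i => (M i i).re) (fun i _ => hdiag i) (Finset.mem_univ i)
  have hdet := (Complex.le_def.1 (hM.submatrix ![a, b]).det_nonneg).1
  have hba : M b a = star (M a b) := (hM.isHermitian.apply b a).symm
  rw [Matrix.det_fin_two] at hdet
  simp [hba, Complex.mul_conj, Complex.normSq_eq_norm_sq, himag] at hdet
  have h0 := (hdiag a).trans (hle a)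
  refine abs_le_of_sq_le_sq' ?_ h0 |>.2
  norm_cast at hdet
  nlinarith [mul_le_mul (hle a) (hle b) (hdiag b) h0]

theorem posSemidef_tsum {w : ℕ → Matrix (Fin d) (Fin d) ℂ} (hw : Summable w)
    (hpos : ∀ k, (w k).PosSemidef) : (∑' k, w k).PosSemidef := by
  refine .of_dotProduct_mulVec_nonneg ?_ fun x => ?_
  · rw [Matrix.IsHermitian, Matrix.conjTranspose_tsum]
    exact tsum_congr fun k => (hpos k).isHermitian
  · have hc : Continuous fun M : Matrix (Fin d) (Fin d) ℂ => star x ⬝ᵥ (M *ᵥ x) := by fun_prop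
    refine (isClosed_Ici.preimage hc).mem_of_tendsto hw.hasSum.tendsto_sum_nat
      (Eventually.of_forall fun n => ?_)
    exact (Matrix.posSemidef_sum _ fun i _ => hpos i).dotProduct_mulVec_nonneg x

/-- The total trace as a linear map. -/
noncomputable def blockTraceLinear : (V → Matrix (Fin d) (Fin d) ℂ) →ₗ[ℂ] ℂ where
  toFun := blockTrace
  map_add' x y := by simp [blockTrace, Finset.sum_add_distrib]
  map_smul' c x := by simp [blockTrace, Finset.mul_sum]

/-- The total trace of a positive block-diagonal operator, as an extended nonnegative real. -/
noncomputable def blockMass (ρ : V → Matrix (Fin d) (Fin d) ℂ) : ℝ≥0∞ :=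
  ENNReal.ofReal (blockTrace ρ).re

theorem blockTrace_nonneg {ρ : V → Matrix (Fin d) (Fin d) ℂ} (hρ : ∀ j, (ρ j).PosSemidef) :
    0 ≤ blockTrace ρ :=
  Finset.sum_nonneg fun j _ => (hρ j).trace_nonneg

theorem blockTrace_re_nonneg {ρ : V → Matrix (Fin d) (Fin d) ℂ} (hρ : ∀ j, (ρ j).PosSemidef) :
    0 ≤ (blockTrace ρ).re :=
  (Complex.le_def.1 (blockTrace_nonneg hρ)).1

theorem blockTrace_eq_ofReal_re {ρ : V → Matrix (Fin d) (Fin d) ℂ}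
    (hρ : ∀ j, (ρ j).PosSemidef) : blockTrace ρ = ((blockTrace ρ).re : ℂ) :=
  Complex.ext rfl (Complex.le_def.1 (blockTrace_nonneg hρ)).2.symm

theorem blockMass_sum {ι : Type*} (s : Finset ι) {w : ι → V → Matrix (Fin d) (Fin d) ℂ}
    (hw : ∀ k j, (w k j).PosSemidef) : blockMass (∑ k ∈ s, w k) = ∑ k ∈ s, blockMass (w k) := by
  have h : blockTrace (∑ k ∈ s, w k) = ∑ k ∈ s, blockTrace (w k) := map_sum blockTraceLinear w s
  simp only [blockMass]
  rw [h, Complex.re_sum, ENNReal.ofReal_sum_of_nonneg fun k _ => blockTrace_re_nonneg (hw k)]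

theorem summable_of_summable_trace {w : ℕ → V → Matrix (Fin d) (Fin d) ℂ}
    (hw : ∀ k j, (w k j).PosSemidef) (hs : Summable fun k => (blockTrace (w k)).re) :
    Summable w := by
  refine Pi.summable.2 fun j => Pi.summable.2 fun a => Pi.summable.2 fun b => ?_
  refine Summable.of_norm_bounded hs fun k => (norm_entry_le_re_trace (hw k j) a b).trans ?_
  rw [blockTrace, Complex.re_sum]
  exact Finset.single_le_sum (f := fun i => (w k i).trace.re)
    (fun i _ => (Complex.le_def.1 (hw k i).trace_nonneg).1) (Finset.mem_univ j)

theorem blockMass_tsum {w : ℕ → V → Matrix (Fin d) (Fin d) ℂ} (hs : Summable w)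
    (hw : ∀ k j, (w k j).PosSemidef) : blockMass (∑' k, w k) = ∑' k, blockMass (w k) := by
  have h := hs.hasSum.map blockTraceLinear blockTraceLinear.continuous_of_finiteDimensional
  have hre := Complex.hasSum_re h
  change HasSum (fun k => (blockTrace (w k)).re) (blockTrace (∑' k, w k)).re at hre
  simp only [blockMass]
  rw [← hre.tsum_eq, ENNReal.ofReal_tsum_of_nonneg (fun k => blockTrace_re_nonneg (hw k))
    hre.summable]

theorem eq_zero_of_blockMass_eq_zero {ρ : V → Matrix (Fin d) (Fin d) ℂ}
    (hρ : ∀ j, (ρ j).PosSemidef) (h : blockMass ρ = 0) : ρ = 0 := by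
  have h0 : blockTrace ρ = 0 := by
    rw [blockTrace_eq_ofReal_re hρ, le_antisymm (ENNReal.ofReal_eq_zero.1 h)
      (blockTrace_re_nonneg hρ), Complex.ofReal_zero]
  funext j
  exact (hρ j).trace_eq_zero_iff.1
    ((Finset.sum_eq_zero_iff_of_nonneg fun i _ => (hρ i).trace_nonneg).1 h0 j (Finset.mem_univ j))

theorem siteProj_posSemidef (S : Finset V) {ρ : V → Matrix (Fin d) (Fin d) ℂ}
    (hρ : ∀ j, (ρ j).PosSemidef) (j : V) : (siteProj S ρ j).PosSemidef := by
  change (if j ∈ S then ρ j else 0).PosSemidef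
  split_ifs
  exacts [hρ j, .zero]

theorem sub_siteProj_posSemidef (S : Finset V) {ρ : V → Matrix (Fin d) (Fin d) ℂ}
    (hρ : ∀ j, (ρ j).PosSemidef) (j : V) :
    (((LinearMap.id - siteProj S) :
      (V → Matrix (Fin d) (Fin d) ℂ) →ₗ[ℂ] (V → Matrix (Fin d) (Fin d) ℂ)) ρ j).PosSemidef := by
  change (ρ j - if j ∈ S then ρ j else 0).PosSemidef
  split_ifs
  · rw [sub_self]; exact .zero
  · rw [sub_zero]; exact hρ j

theorem tomAct_posSemidef
    {E : V → V → (Matrix (Fin d) (Fin d) ℂ →ₗ[ℂ] Matrix (Fin d) (Fin d) ℂ)}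
    (hE : ∀ i j, IsCPMap (E i j)) {ρ : V → Matrix (Fin d) (Fin d) ℂ}
    (hρ : ∀ j, (ρ j).PosSemidef) (i : V) : (tomAct E ρ i).PosSemidef := by
  refine Matrix.posSemidef_sum _ fun j _ => ?_
  obtain ⟨m, B, hB⟩ := hE i j
  rw [hB]
  exact Matrix.posSemidef_sum _ fun k _ => (hρ j).mul_mul_conjTranspose_same (B k)

theorem retA_posSemidef
    {E : V → V → (Matrix (Fin d) (Fin d) ℂ →ₗ[ℂ] Matrix (Fin d) (Fin d) ℂ)}
    (hE : ∀ i j, IsCPMap (E i j)) (S : Finset V) (n : ℕ) {ρ : V → Matrix (Fin d) (Fin d) ℂ}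
    (hρ : ∀ j, (ρ j).PosSemidef) (i : V) : (retA E S n ρ i).PosSemidef := by
  refine siteProj_posSemidef S (tomAct_posSemidef hE ?_) i
  induction n with
  | zero => exact siteProj_posSemidef S hρ
  | succ n ih =>
    simp only [LinearMap.comp_apply] at ih ⊢
    rw [pow_succ']
    exact sub_siteProj_posSemidef S (tomAct_posSemidef hE ih)

theorem retA_apply_of_notMem
    (E : V → V → (Matrix (Fin d) (Fin d) ℂ →ₗ[ℂ] Matrix (Fin d) (Fin d) ℂ))
    {S : Finset V} (n : ℕ) (ρ : V → Matrix (Fin d) (Fin d) ℂ) {i : V} (hi : i ∉ S) :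
    retA E S n ρ i = 0 :=
  if_neg hi

theorem returnProb_eq_one_iff
    {E : V → V → (Matrix (Fin d) (Fin d) ℂ →ₗ[ℂ] Matrix (Fin d) (Fin d) ℂ)}
    (hE : ∀ i j, IsCPMap (E i j)) (S : Finset V) {ρ : V → Matrix (Fin d) (Fin d) ℂ}
    (hρ : ∀ j, (ρ j).PosSemidef) :
    returnProb E S ρ = 1 ↔ ∑' n, blockMass (retA E S n ρ) = 1 :=
  tsum_eq_one_iff_tsum_ofReal fun n => blockTrace_re_nonneg (retA_posSemidef hE S n hρ)

theorem expReturnTime_eq_tsum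
    {E : V → V → (Matrix (Fin d) (Fin d) ℂ →ₗ[ℂ] Matrix (Fin d) (Fin d) ℂ)}
    {S : Finset V} {ρ : V → Matrix (Fin d) (Fin d) ℂ} (h : returnProb E S ρ = 1) :
    expReturnTime E S ρ = ∑' n : ℕ, ((n : ℝ≥0∞) + 1) * blockMass (retA E S n ρ) := by
  rw [expReturnTime, if_pos h]
  refine tsum_congr fun n => ?_
  rw [ENNReal.ofReal_mul (by positivity), ENNReal.ofReal_add (by positivity) zero_le_one]
  simp [blockMass]

/-- Return to a recurrent sum of sites preserves the trace of positive operators on it. -/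
theorem tsum_blockMass_retA_of_recurrentOn
    {E : V → V → (Matrix (Fin d) (Fin d) ℂ →ₗ[ℂ] Matrix (Fin d) (Fin d) ℂ)}
    (hE : ∀ i j, IsCPMap (E i j)) {S : Finset V} (hrec : RecurrentOn E S)
    {w : V → Matrix (Fin d) (Fin d) ℂ} (hw : ∀ j, (w j).PosSemidef)
    (hwS : ∀ j ∉ S, w j = 0) : ∑' n, blockMass (retA E S n w) = blockMass w := by
  rcases eq_or_ne (blockMass w) 0 with h | h
  · simp [eq_zero_of_blockMass_eq_zero hw h, blockMass, blockTrace]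
  set c := (blockTrace w).re with hc
  have hcpos : 0 < c := by
    by_contra hneg
    exact h (ENNReal.ofReal_eq_zero.2 (not_lt.1 hneg))
  have hcC : (c : ℂ) ≠ 0 := by exact_mod_cast hcpos.ne'
  set ρ := ((c⁻¹ : ℝ) : ℂ) • w with hρ
  have hwρ : w = (c : ℂ) • ρ := by
    rw [hρ, smul_smul, Complex.ofReal_inv, mul_inv_cancel₀ hcC, one_smul]
  have hpos : ∀ j, (ρ j).PosSemidef := fun j =>
    (hw j).smul (by exact_mod_cast (inv_pos.2 hcpos).le)
  have hdens : DensityOn S ρ := by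
    refine ⟨hpos, fun j hj => by simp [hρ, hwS j hj], ?_⟩
    rw [show blockTrace ρ = ((c⁻¹ : ℝ) : ℂ) * blockTrace w from
      map_smul blockTraceLinear _ w, blockTrace_eq_ofReal_re hw, ← hc, Complex.ofReal_inv,
      inv_mul_cancel₀ hcC]
  have hscale : ∀ n, blockMass (retA E S n w) =
      ENNReal.ofReal c * blockMass (retA E S n ρ) := fun n => by
    rw [hwρ, map_smul, blockMass, show blockTrace ((c : ℂ) • retA E S n ρ) =
      (c : ℂ) * blockTrace (retA E S n ρ) from map_smul blockTraceLinear _ _,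
      Complex.re_ofReal_mul, ENNReal.ofReal_mul hcpos.le]
    rfl
  simp_rw [hscale]
  rw [ENNReal.tsum_mul_left, (returnProb_eq_one_iff hE S hpos).1 (hrec ρ hdens), mul_one]
  rfl

theorem siteProj_mul (S T : Finset V) :
    (siteProj S * siteProj T : Module.End ℂ (V → Matrix (Fin d) (Fin d) ℂ)) =
      siteProj (S ∩ T) := by
  refine LinearMap.ext fun ρ => funext fun i => ?_
  change (if i ∈ S then (if i ∈ T then ρ i else 0) else 0) = if i ∈ S ∩ T then ρ i else 0
  simp only [Finset.mem_inter, ite_and]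

theorem siteProj_mul_of_disjoint {S T : Finset V} (h : Disjoint S T) :
    (siteProj S * siteProj T : Module.End ℂ (V → Matrix (Fin d) (Fin d) ℂ)) = 0 := by
  rw [siteProj_mul, Finset.disjoint_iff_inter_eq_empty.1 h]
  refine LinearMap.ext fun ρ => funext fun i => ?_
  change (if i ∈ (∅ : Finset V) then ρ i else 0) = 0
  exact if_neg (Finset.notMem_empty i)

theorem siteProj_mul_tomAct {S T : Finset V} (h : Disjoint S T)
    {E : V → V → (Matrix (Fin d) (Fin d) ℂ →ₗ[ℂ] Matrix (Fin d) (Fin d) ℂ)}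
    (hE : ∀ i j, (i ∉ T ∨ j ∉ T) → E i j = 0) :
    (siteProj S * tomAct E : Module.End ℂ (V → Matrix (Fin d) (Fin d) ℂ)) = 0 := by
  refine LinearMap.ext fun ρ => funext fun i => ?_
  change (if i ∈ S then ∑ j, E i j (ρ j) else 0) = 0
  split_ifs with hi
  · exact Finset.sum_eq_zero fun j _ => by
      rw [hE i j (.inl (Finset.disjoint_left.1 h hi)), LinearMap.zero_apply]
  · rfl

theorem tomAct_mul_siteProj {S T : Finset V} (h : Disjoint S T)
    {E : V → V → (Matrix (Fin d) (Fin d) ℂ →ₗ[ℂ] Matrix (Fin d) (Fin d) ℂ)}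
    (hE : ∀ i j, (i ∉ T ∨ j ∉ T) → E i j = 0) :
    (tomAct E * siteProj S : Module.End ℂ (V → Matrix (Fin d) (Fin d) ℂ)) = 0 := by
  refine LinearMap.ext fun ρ => funext fun i => ?_
  change ∑ j, E i j (if j ∈ S then ρ j else 0) = 0
  refine Finset.sum_eq_zero fun j _ => ?_
  split_ifs with hj
  · rw [hE i j (.inr (Finset.disjoint_left.1 h hj)), LinearMap.zero_apply]
  · exact map_zero _

theorem tomAct_extById (S : Finset V)
    (E : V → V → (Matrix (Fin d) (Fin d) ℂ →ₗ[ℂ] Matrix (Fin d) (Fin d) ℂ)) :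
    tomAct (extById S E) = tomAct E + siteProj S := by
  refine LinearMap.ext fun ρ => funext fun i => ?_
  change ∑ j, (extById S E i j) (ρ j) =
    ∑ j, E i j (ρ j) + if i ∈ S then ρ i else 0
  simp only [extById, LinearMap.add_apply, Finset.sum_add_distrib]
  congr 1
  rw [Finset.sum_eq_single i]
  · by_cases hi : i ∈ S <;> simp [hi]
  · intro j _ hj
    simp [hj.symm]
  · simp

theorem siteProj_add_add_eq_one {Vm V0 Vp : Finset V}
    (hd1 : Disjoint Vm V0) (hd2 : Disjoint V0 Vp) (hd3 : Disjoint Vm Vp)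
    (hcover : Vm ∪ V0 ∪ Vp = Finset.univ) :
    (siteProj Vm + siteProj V0 + siteProj Vp :
      Module.End ℂ (V → Matrix (Fin d) (Fin d) ℂ)) = 1 := by
  refine LinearMap.ext fun ρ => funext fun i => ?_
  change (if i ∈ Vm then ρ i else 0) + (if i ∈ V0 then ρ i else 0) +
    (if i ∈ Vp then ρ i else 0) = ρ i
  have hi : i ∈ Vm ∪ V0 ∪ Vp := hcover ▸ Finset.mem_univ i
  rw [Finset.mem_union, Finset.mem_union] at hi
  rcases hi with (hi | hi) | hi
  · simp [hi, Finset.disjoint_left.1 hd1 hi, Finset.disjoint_left.1 hd3 hi]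
  · simp [hi, Finset.disjoint_right.1 hd1 hi, Finset.disjoint_left.1 hd2 hi]
  · simp [hi, Finset.disjoint_right.1 hd2 hi, Finset.disjoint_right.1 hd3 hi]

/-- The first-return coefficients of an overlapping factorization are the Cauchy product of those
of its factors. -/
theorem retA_factorization {Vm V0 Vp : Finset V}
    (hd1 : Disjoint Vm V0) (hd2 : Disjoint V0 Vp) (hd3 : Disjoint Vm Vp)
    (hcover : Vm ∪ V0 ∪ Vp = Finset.univ)
    {E EL ER : V → V → (Matrix (Fin d) (Fin d) ℂ →ₗ[ℂ] Matrix (Fin d) (Fin d) ℂ)}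
    (hL : ∀ i j, (i ∉ Vm ∪ V0 ∨ j ∉ Vm ∪ V0) → EL i j = 0)
    (hR : ∀ i j, (i ∉ V0 ∪ Vp ∨ j ∉ V0 ∪ Vp) → ER i j = 0)
    (hfac : tomAct E = (tomAct (extById Vp EL)) ∘ₗ (tomAct (extById Vm ER)))
    (n : ℕ) (ρ : V → Matrix (Fin d) (Fin d) ℂ) :
    retA E V0 n ρ =
      ∑ x ∈ Finset.HasAntidiagonal.antidiagonal n, retA EL V0 x.2 (retA ER V0 x.1 ρ) := by
  have hp : Disjoint Vp (Vm ∪ V0) := Finset.disjoint_union_right.2 ⟨hd3.symm, hd2.symm⟩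
  have hm : Disjoint Vm (V0 ∪ Vp) := Finset.disjoint_union_right.2 ⟨hd1, hd3⟩
  have hidem : ∀ S : Finset V, (siteProj S * siteProj S :
      Module.End ℂ (V → Matrix (Fin d) (Fin d) ℂ)) = siteProj S := fun S => by
    rw [siteProj_mul, Finset.inter_self]
  have key := first_return_eq_sum_antidiagonal
    (R := Module.End ℂ (V → Matrix (Fin d) (Fin d) ℂ))
    (siteProj_add_add_eq_one hd1 hd2 hd3 hcover) (hidem V0) (hidem Vm) (hidem Vp)
    (siteProj_mul_of_disjoint hd1) (siteProj_mul_of_disjoint hd2)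
    (siteProj_mul_of_disjoint hd3) (siteProj_mul_of_disjoint hd3.symm)
    (siteProj_mul_tomAct hp hL) (tomAct_mul_siteProj hp hL)
    (siteProj_mul_tomAct hm hR) (tomAct_mul_siteProj hm hR) n
  rw [← tomAct_extById, ← tomAct_extById] at key
  have hfac' : tomAct E = tomAct (extById Vp EL) * tomAct (extById Vm ER) := hfac
  rw [← hfac'] at key
  have happ := LinearMap.congr_fun key ρ
  rw [LinearMap.sum_apply] at happ
  exact happ

/-- Factorization rule for the expected return time: if a TOM
`E` has an overlapping factorization `E = (E_L ⊕ I₊)(I₋ ⊕ E_R)` with overlap `V₀`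
and `S₀` is recurrent for `E_L`, then for every density `ρ` supported on `S₀`:
if `π_R(ρ→S₀) = 1` then `σ = f_R(1)(ρ)` is a density supported on `S₀` and
`τ(ρ→S₀) + 1 = τ_L(σ→S₀) + τ_R(ρ→S₀)` in `[1,∞]`, while if `π_R(ρ→S₀) < 1` then
`τ(ρ→S₀) = ∞`. Consequently `S₀` is positive recurrent for `E` whenever it is
positive recurrent for both `E_L` and `E_R`. -/
theorem tom_factorization_expected_return_time
    (Vm V0 Vp : Finset V)
    (hd1 : Disjoint Vm V0) (hd2 : Disjoint V0 Vp) (hd3 : Disjoint Vm Vp)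
    (hcover : Vm ∪ V0 ∪ Vp = Finset.univ)
    (E EL ER : V → V → (Matrix (Fin d) (Fin d) ℂ →ₗ[ℂ] Matrix (Fin d) (Fin d) ℂ))
    (hE : IsTOMOn Finset.univ E)
    (hL : IsTOMOn (Vm ∪ V0) EL) (hR : IsTOMOn (V0 ∪ Vp) ER)
    (hfac : tomAct E = (tomAct (extById Vp EL)) ∘ₗ (tomAct (extById Vm ER)))
    (hrecL : RecurrentOn EL V0) :
    (∀ ρ, DensityOn V0 ρ →
      (returnProb ER V0 ρ = 1 →
        DensityOn V0 (∑' m : ℕ, (retA ER V0 m) ρ) ∧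
        expReturnTime E V0 ρ + 1 =
          expReturnTime EL V0 (∑' m : ℕ, (retA ER V0 m) ρ) +
            expReturnTime ER V0 ρ) ∧
      (returnProb ER V0 ρ < 1 → expReturnTime E V0 ρ = ⊤)) ∧
    (PosRecurrentOn EL V0 → PosRecurrentOn ER V0 → PosRecurrentOn E V0) := by
  have hconv := retA_factorization hd1 hd2 hd3 hcover hL.2.1 hR.2.1 hfac
  have hrule : ∀ ρ, DensityOn V0 ρ →
      (returnProb ER V0 ρ = 1 →
        DensityOn V0 (∑' m : ℕ, (retA ER V0 m) ρ) ∧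
        expReturnTime E V0 ρ + 1 =
          expReturnTime EL V0 (∑' m : ℕ, (retA ER V0 m) ρ) +
            expReturnTime ER V0 ρ) ∧
      (returnProb ER V0 ρ < 1 → expReturnTime E V0 ρ = ⊤) := by
    intro ρ hρ
    have hwpos : ∀ k j, (retA ER V0 k ρ j).PosSemidef := fun k =>
      retA_posSemidef hR.1 V0 k hρ.1
    have hLpos : ∀ m k j, (retA EL V0 m (retA ER V0 k ρ) j).PosSemidef := fun m k =>
      retA_posSemidef hL.1 V0 m (hwpos k)
    have hmass : ∀ n, blockMass (retA E V0 n ρ) =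
        ∑ x ∈ Finset.HasAntidiagonal.antidiagonal n, blockMass (retA EL V0 x.2 (retA ER V0 x.1 ρ)) := fun n => by
      rw [hconv, blockMass_sum _ fun x : ℕ × ℕ => hLpos x.2 x.1]
    have hcol : ∀ k, ∑' m, blockMass (retA EL V0 m (retA ER V0 k ρ)) =
        blockMass (retA ER V0 k ρ) := fun k =>
      tsum_blockMass_retA_of_recurrentOn hL.1 hrecL (hwpos k)
        fun j hj => retA_apply_of_notMem ER k ρ hj
    have hprob : returnProb E V0 ρ = 1 ↔ returnProb ER V0 ρ = 1 := by
      rw [returnProb_eq_one_iff hE.1 V0 hρ.1, returnProb_eq_one_iff hR.1 V0 hρ.1]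
      simp_rw [hmass]
      rw [tsum_sum_antidiagonal_ennreal
        fun x => blockMass (retA EL V0 x.2 (retA ER V0 x.1 ρ))]
      simp_rw [hcol]
    refine ⟨fun h1 => ?_, fun h1 => if_neg fun h => h1.ne (hprob.1 h)⟩
    have hsumtr : Summable fun k => (blockTrace (retA ER V0 k ρ)).re := by
      by_contra hs
      rw [returnProb, tsum_eq_zero_of_not_summable hs] at h1
      exact zero_ne_one h1
    have hsum := summable_of_summable_trace hwpos hsumtr
    have hone := (returnProb_eq_one_iff hR.1 V0 hρ.1).1 h1
    have hσ : DensityOn V0 (∑' m : ℕ, (retA ER V0 m) ρ) := by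
      have hσpos : ∀ j, ((∑' m : ℕ, (retA ER V0 m) ρ) j).PosSemidef := fun j => by
        rw [tsum_apply hsum]
        exact posSemidef_tsum (Pi.summable.1 hsum j) fun k => hwpos k j
      refine ⟨hσpos, fun j hj => ?_, ?_⟩
      · rw [tsum_apply hsum]
        simp [retA_apply_of_notMem ER _ ρ hj]
      · have h := blockMass_tsum hsum hwpos
        rw [hone, blockMass, ENNReal.ofReal_eq_one] at h
        rw [blockTrace_eq_ofReal_re hσpos, h, Complex.ofReal_one]
    refine ⟨hσ, ?_⟩
    have hrow : ∀ m, blockMass (retA EL V0 m (∑' k : ℕ, (retA ER V0 k) ρ)) =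
        ∑' k, blockMass (retA EL V0 m (retA ER V0 k ρ)) := fun m => by
      have h := hsum.hasSum.map (retA EL V0 m) (retA EL V0 m).continuous_of_finiteDimensional
      rw [← h.tsum_eq]
      exact blockMass_tsum h.summable (hLpos m)
    rw [expReturnTime_eq_tsum (hprob.2 h1), expReturnTime_eq_tsum (hrecL _ hσ),
      expReturnTime_eq_tsum h1]
    have hleft : ∑' n : ℕ, ((n : ℝ≥0∞) + 1) * blockMass (retA E V0 n ρ) =
        ∑' k : ℕ, ∑' m : ℕ, ((k : ℝ≥0∞) + m + 1) *
          blockMass (retA EL V0 m (retA ER V0 k ρ)) := by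
      rw [← tsum_sum_antidiagonal_ennreal fun x => ((x.1 : ℝ≥0∞) + x.2 + 1) *
        blockMass (retA EL V0 x.2 (retA ER V0 x.1 ρ))]
      refine tsum_congr fun n => ?_
      rw [hmass, Finset.mul_sum]
      refine Finset.sum_congr rfl fun x hx => ?_
      rw [← Finset.HasAntidiagonal.mem_antidiagonal.1 hx, Nat.cast_add]
    have hfirst : ∑' m : ℕ, ((m : ℝ≥0∞) + 1) *
          blockMass (retA EL V0 m (∑' k : ℕ, (retA ER V0 k) ρ)) =
        ∑' k : ℕ, ∑' m : ℕ, ((m : ℝ≥0∞) + 1) *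
          blockMass (retA EL V0 m (retA ER V0 k ρ)) := by
      rw [ENNReal.tsum_comm]
      exact tsum_congr fun m => by rw [hrow, ENNReal.tsum_mul_left]
    rw [hleft, hfirst, ← ENNReal.tsum_add]
    refine (congrArg (_ + ·) hone.symm).trans ?_
    rw [← ENNReal.tsum_add]
    refine tsum_congr fun k => ?_
    rw [← hcol k, ← ENNReal.tsum_mul_left, ← ENNReal.tsum_add, ← ENNReal.tsum_add]
    exact tsum_congr fun m => by ring
  refine ⟨hrule, fun hposL hposR ρ hρ => ?_⟩
  have h1 : returnProb ER V0 ρ = 1 := by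
    by_contra h
    exact (hposR ρ hρ).ne (if_neg h)
  obtain ⟨hσ, heq⟩ := (hrule ρ hρ).1 h1
  refine lt_of_le_of_lt le_self_add (b := expReturnTime E V0 ρ + 1) ?_
  rw [heq]
  exact ENNReal.add_lt_top.2 ⟨hposL _ hσ, hposR ρ hρ⟩

end QMCTOM
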